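/- Let w = Π_i u_i v_i ∈ M_{m_k} with u_i ∈ M_{e_i} and v_i ∈ M_{d_i}. Suppose there exist elements g_1, ..., g_t ∈ A with t ≤ 10^{-4}·m_k^2 such that R_k(w(n1,...,n6)) ∈ R_k(S(w)) + Σ_{i=1}^{t} K·g_i for all n1,...,n6. Then R_k(w(n1,...,n6)) ∈ R_k(S(w)) for all n1,...,n6. -/

import Mathlib

open scoped Classical BigOperators

noncomputable section

/-- The free associative unital `K`-algebra on six generators `x1 x2 x3 y1 y2 y3`,
realized as the monoid algebra of the free monoid on six letters. -/
abbrev FreeA (K : Type) [Field K] : Type := MonoidAlgebra K (FreeMonoid (Fin 6))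

/-- The map sending the generators `x1 x2 x3` to `x` and `y1 y2 y3` to `y`. -/
def bf : Fin 6 → Fin 2 := fun i => if (i : ℕ) < 3 then 0 else 1

/-- The monoid homomorphism `β` from monomials in six letters to monomials in two letters. -/
def bm : FreeMonoid (Fin 6) →* FreeMonoid (Fin 2) := FreeMonoid.map bf

/-- Degree (length) of a monomial. -/
def len {α : Type} (w : FreeMonoid α) : ℕ := (FreeMonoid.toList w).length

/-- The ordering `≺` on monomials in `x, y`: same degree and lexicographically smaller. -/
def prec (z z' : FreeMonoid (Fin 2)) : Prop :=
  len z = len z' ∧ List.Lex (· < ·) (FreeMonoid.toList z) (FreeMonoid.toList z')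

/-- The finite set of monomials of degree `n` in six letters. -/
def wordsOf (n : ℕ) : Finset (FreeMonoid (Fin 6)) :=
  (Finset.univ : Finset (Fin n → Fin 6)).image fun f => FreeMonoid.ofList (List.ofFn f)

/-- `wComp K z n` is `z(n₁,…,n₆)`: the sum of all monomials `v` (in six letters) with
`β v = z` and with exactly `nᵢ` occurrences of the `i`-th generator; it is `0` if no such
monomial exists (in particular if some `nᵢ` is negative). -/
def wComp (K : Type) [Field K] (z : FreeMonoid (Fin 2)) (n : Fin 6 → ℤ) : FreeA K :=
  ∑ v ∈ (wordsOf (len z)).filter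
      (fun v => bm v = z ∧ ∀ e : Fin 6, ((FreeMonoid.toList v).count e : ℤ) = n e),
    MonoidAlgebra.single v 1

/-- `H_i`: the `K`-span of the monomials of degree `i`. -/
def Hgr (K : Type) [Field K] (i : ℕ) : Submodule K (FreeA K) :=
  Submodule.span K {a | ∃ w : FreeMonoid (Fin 6), len w = i ∧ a = MonoidAlgebra.single w (1 : K)}

/-- `S(z)` for `z` a monomial in `x, y`: the span of the monomials `w` in six letters of the
same degree with `β w ≺ z`.  (For a monomial `z` in six letters, `S(z) = SP K (bm z)`.) -/
def SP (K : Type) [Field K] (z : FreeMonoid (Fin 2)) : Submodule K (FreeA K) :=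
  Submodule.span K
    {a | ∃ w : FreeMonoid (Fin 6), len w = len z ∧ prec (bm w) z ∧
      a = MonoidAlgebra.single w (1 : K)}

/-- `Q(z)`: the span of the monomials `w` of the same degree with `β w = z`. -/
def QP (K : Type) [Field K] (z : FreeMonoid (Fin 2)) : Submodule K (FreeA K) :=
  Submodule.span K
    {a | ∃ w : FreeMonoid (Fin 6), len w = len z ∧ bm w = z ∧
      a = MonoidAlgebra.single w (1 : K)}

end

noncomputable section

/-- The monomial of degree `n` given by a function on letter positions. -/
def wordOfFn {n : ℕ} (f : Fin n → Fin 6) : FreeMonoid (Fin 6) :=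
  FreeMonoid.ofList (List.ofFn f)

end

/-- The word in an alphabet `α` spelled by a function on letter positions. -/
def spell {α : Type} {n : ℕ} (f : Fin n → α) : FreeMonoid α := FreeMonoid.ofList (List.ofFn f)

/-- The word obtained by alternating the blocks spelled by `a` with those spelled by `b`. -/
def interleave {α : Type} {s : ℕ} {e d : Fin s → ℕ} (a : ∀ i, Fin (e i) → α)
    (b : ∀ i, Fin (d i) → α) : FreeMonoid α :=
  (List.ofFn fun i => spell (a i) * spell (b i)).prod

/-- The number of occurrences of each letter in a family of blocks. -/
def letterCount {α : Type} [DecidableEq α] {s : ℕ} {e : Fin s → ℕ}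
    (a : ∀ i, Fin (e i) → α) : α → ℤ :=
  fun l => ∑ i, ∑ j, if a i j = l then 1 else 0

theorem len_mul {α : Type} (x y : FreeMonoid α) : len (x * y) = len x + len y := by
  simp [len]

theorem len_spell {α : Type} {n : ℕ} (f : Fin n → α) : len (spell f) = n := by
  simp [len, spell]

theorem exists_spell_eq {α : Type} {n : ℕ} {x : FreeMonoid α} (hx : len x = n) :
    ∃ f : Fin n → α, spell f = x := by
  subst hx
  exact ⟨fun i => (FreeMonoid.toList x).get i,
    congrArg FreeMonoid.ofList (List.ofFn_get (FreeMonoid.toList x))⟩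

theorem spell_injective {α : Type} {n : ℕ} :
    Function.Injective (spell : (Fin n → α) → FreeMonoid α) := fun _ _ h =>
  List.ofFn_injective (FreeMonoid.ofList.injective h)

theorem eq_of_mul_eq_of_len {α : Type} {x x' y y' : FreeMonoid α} (h : x * y = x' * y')
    (hl : len x = len x') : x = x' ∧ y = y' := by
  have := congrArg FreeMonoid.toList h
  rw [FreeMonoid.toList_mul, FreeMonoid.toList_mul] at this
  obtain ⟨h1, h2⟩ := List.append_inj this hl
  exact ⟨FreeMonoid.toList.injective h1, FreeMonoid.toList.injective h2⟩

theorem ofFn_prod_injective_of_len {α : Type} {s : ℕ} {F F' : Fin s → FreeMonoid α}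
    (hl : ∀ i, len (F i) = len (F' i)) (h : (List.ofFn F).prod = (List.ofFn F').prod) :
    F = F' := by
  induction s with
  | zero => exact Subsingleton.elim _ _
  | succ s ih =>
    simp only [List.ofFn_succ, List.prod_cons] at h
    obtain ⟨h1, h2⟩ := eq_of_mul_eq_of_len h (hl 0)
    have h3 := ih (fun i => hl i.succ) h2
    funext i
    exact Fin.cases h1 (fun j => congrFun h3 j) i

theorem exists_mul_eq_of_len {α : Type} {x : FreeMonoid α} {p q : ℕ} (hx : len x = p + q) :
    ∃ y z, len y = p ∧ len z = q ∧ x = y * z := by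
  refine ⟨FreeMonoid.ofList ((FreeMonoid.toList x).take p),
    FreeMonoid.ofList ((FreeMonoid.toList x).drop p), ?_, ?_, ?_⟩
  · simp only [len] at *
    simp [hx]
  · simp only [len] at *
    simp [hx]
  · apply FreeMonoid.toList.injective
    simp

theorem exists_ofFn_prod_eq {α : Type} {s : ℕ} {n : Fin s → ℕ} {x : FreeMonoid α}
    (hx : len x = ∑ i, n i) :
    ∃ F : Fin s → FreeMonoid α, (∀ i, len (F i) = n i) ∧ (List.ofFn F).prod = x := by
  induction s generalizing x with
  | zero =>
    refine ⟨fun i => i.elim0, fun i => i.elim0, ?_⟩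
    have : FreeMonoid.toList x = [] := List.eq_nil_of_length_eq_zero (by simpa [len] using hx)
    apply FreeMonoid.toList.injective
    simp [this]
  | succ s ih =>
    rw [Fin.sum_univ_succ] at hx
    obtain ⟨y, z, hy, hz, rfl⟩ := exists_mul_eq_of_len hx
    obtain ⟨F, hF, rfl⟩ := ih hz
    refine ⟨Fin.cons y F, fun i => Fin.cases hy hF i, ?_⟩
    simp [List.ofFn_succ]

theorem count_ofFn_prod {α : Type} [DecidableEq α] {s : ℕ} (F : Fin s → FreeMonoid α) (l : α) :
    (FreeMonoid.toList (List.ofFn F).prod).count l =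
      ∑ i, (FreeMonoid.toList (F i)).count l := by
  induction s with
  | zero => simp
  | succ s ih =>
    rw [List.ofFn_succ, List.prod_cons, FreeMonoid.toList_mul, List.count_append, ih,
      Fin.sum_univ_succ]

theorem count_spell {α : Type} [DecidableEq α] {n : ℕ} (f : Fin n → α) (l : α) :
    (FreeMonoid.toList (spell f)).count l = ∑ j, if f j = l then 1 else 0 := by
  simp only [spell, FreeMonoid.toList_ofList]
  induction n with
  | zero => simp
  | succ n ih =>
    rw [List.ofFn_succ, List.count_cons, ih, Fin.sum_univ_succ, add_comm]
    simp

section Interleave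

variable {α : Type} {s : ℕ} {e d : Fin s → ℕ}

theorem len_interleave (a : ∀ i, Fin (e i) → α) (b : ∀ i, Fin (d i) → α) :
    len (interleave a b) = ∑ i, (e i + d i) := by
  have h : ∀ {t : ℕ} (F : Fin t → FreeMonoid α), len (List.ofFn F).prod = ∑ i, len (F i) := by
    intro t F
    induction t with
    | zero => simp [len]
    | succ t ih => rw [List.ofFn_succ, List.prod_cons, len_mul, ih, Fin.sum_univ_succ]
  simp [interleave, h, len_mul, len_spell]

theorem interleave_inj {a a' : ∀ i, Fin (e i) → α} {b b' : ∀ i, Fin (d i) → α} :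
    interleave a b = interleave a' b' ↔ a = a' ∧ b = b' := by
  refine ⟨fun h => ?_, fun h => by rw [h.1, h.2]⟩
  have h1 := ofFn_prod_injective_of_len (fun i => by simp [len_mul, len_spell]) h
  have h2 := fun i => eq_of_mul_eq_of_len (congrFun h1 i) (by simp [len_spell])
  exact ⟨funext fun i => spell_injective (h2 i).1, funext fun i => spell_injective (h2 i).2⟩

theorem exists_interleave_eq {x : FreeMonoid α} (hx : len x = ∑ i, (e i + d i)) :
    ∃ (a : ∀ i, Fin (e i) → α) (b : ∀ i, Fin (d i) → α), interleave a b = x := by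
  obtain ⟨F, hF, rfl⟩ := exists_ofFn_prod_eq hx
  choose y z hy hz hyz using fun i => exists_mul_eq_of_len (hF i)
  choose a ha using fun i => exists_spell_eq (hy i)
  choose b hb using fun i => exists_spell_eq (hz i)
  refine ⟨a, b, ?_⟩
  simp only [interleave, ha, hb, ← hyz]

theorem count_interleave [DecidableEq α] (a : ∀ i, Fin (e i) → α) (b : ∀ i, Fin (d i) → α)
    (l : α) :
    ((FreeMonoid.toList (interleave a b)).count l : ℤ) = letterCount a l + letterCount b l := by
  rw [interleave, count_ofFn_prod]
  simp only [FreeMonoid.toList_mul, List.count_append, count_spell, letterCount]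
  push_cast
  rw [Finset.sum_add_distrib]

theorem bm_interleave (a : ∀ i, Fin (e i) → Fin 6) (b : ∀ i, Fin (d i) → Fin 6) :
    bm (interleave a b) = interleave (fun i => bf ∘ a i) (fun i => bf ∘ b i) := by
  rw [interleave, map_list_prod, List.map_ofFn, interleave]
  congr 2
  funext i
  simp only [Function.comp_apply, map_mul]
  congr 1 <;> simp [bm, spell, FreeMonoid.ofList_map, ← List.map_ofFn]

end Interleave

theorem mem_wordsOf {n : ℕ} {x : FreeMonoid (Fin 6)} : x ∈ wordsOf n ↔ len x = n := by
  simp only [wordsOf, Finset.mem_image, Finset.mem_univ, true_and]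
  refine ⟨?_, fun h => exists_spell_eq h⟩
  rintro ⟨f, rfl⟩
  exact len_spell f

theorem wComp_interleave (K : Type) [Field K] {s : ℕ} {e d : Fin s → ℕ}
    (p : ∀ i, Fin (e i) → Fin 2) (q : ∀ i, Fin (d i) → Fin 2) (n : Fin 6 → ℤ) :
    wComp K (interleave p q) n =
      ∑ a : ∀ i, Fin (e i) → Fin 6 with (fun i => bf ∘ a i) = p,
        ∑ b : ∀ i, Fin (d i) → Fin 6 with
          (fun i => bf ∘ b i) = q ∧ letterCount b = n - letterCount a,
          MonoidAlgebra.single (interleave a b) 1 := by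
  rw [Finset.sum_sigma', wComp]
  symm
  refine Finset.sum_bij (fun x _ => interleave x.1 x.2) ?_ ?_ ?_ (fun _ _ => rfl)
  · rintro ⟨a, b⟩ h
    simp only [Finset.mem_sigma, Finset.mem_filter, Finset.mem_univ, true_and] at h
    obtain ⟨rfl, rfl, hc⟩ := h
    simp only [Finset.mem_filter, mem_wordsOf, len_interleave, bm_interleave, true_and]
    intro l
    have := congrFun hc l
    convert count_interleave a b l using 1
    simp [this]
  · rintro ⟨a, b⟩ _ ⟨a', b'⟩ _ h
    obtain ⟨h1, h2⟩ := interleave_inj.1 h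
    simp only at h1 h2
    rw [h1, h2]
  · intro x hx
    simp only [Finset.mem_filter, mem_wordsOf, len_interleave] at hx
    obtain ⟨hl, hb, hc⟩ := hx
    obtain ⟨a, b, rfl⟩ := exists_interleave_eq hl
    rw [bm_interleave, interleave_inj] at hb
    refine ⟨⟨a, b⟩, ?_, rfl⟩
    simp only [Finset.mem_sigma, Finset.mem_filter, Finset.mem_univ, true_and]
    refine ⟨hb.1, hb.2, funext fun l => ?_⟩
    have := hc l
    rw [Pi.sub_apply, ← this]
    have h2 := count_interleave a b l
    rw [eq_sub_iff_add_eq, add_comm, ← h2]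

theorem eq_sum_spell_of_mem_Hgr {K : Type} [Field K] {n : ℕ} {x : FreeA K} (hx : x ∈ Hgr K n) :
    x = ∑ f : Fin n → Fin 6, x.coeff (spell f) • MonoidAlgebra.single (spell f) (1 : K) := by
  induction hx using Submodule.span_induction with
  | mem x hx =>
    obtain ⟨w, hw, rfl⟩ := hx
    obtain ⟨f, rfl⟩ := exists_spell_eq hw
    rw [Finset.sum_eq_single f]
    · simp
    · intro g _ hg
      rw [MonoidAlgebra.coeff_single, Finsupp.single_eq_of_ne, zero_smul]
      exact fun h => hg (spell_injective h)
    · simp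
  | zero => simp
  | add x y _ _ hx hy =>
    conv_lhs => rw [hx, hy]
    simp [add_smul, Finset.sum_add_distrib]
  | smul r x _ hx =>
    conv_lhs => rw [hx]
    simp [Finset.smul_sum, mul_smul]

theorem ofFn_prod_single {K : Type} [Field K] {s : ℕ} (F : Fin s → FreeMonoid (Fin 6)) :
    (List.ofFn fun i => MonoidAlgebra.single (F i) (1 : K)).prod =
      MonoidAlgebra.single (List.ofFn F).prod 1 := by
  have := map_list_prod (MonoidAlgebra.of K (FreeMonoid (Fin 6))) (List.ofFn F)
  rw [List.map_ofFn] at this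
  exact this.symm

theorem ofFn_prod_eq_sum_interleave {K : Type} [Field K] {s : ℕ} {e d : Fin s → ℕ}
    (a : ∀ i, Fin (e i) → Fin 6) {y : Fin s → FreeA K} (hy : ∀ i, y i ∈ Hgr K (d i)) :
    (List.ofFn fun i => MonoidAlgebra.single (spell (a i)) (1 : K) * y i).prod =
      ∑ b : ∀ i, Fin (d i) → Fin 6, (∏ i, (y i).coeff (spell (b i))) •
        MonoidAlgebra.single (interleave a b) 1 := by
  have h : (fun i => MonoidAlgebra.single (spell (a i)) (1 : K) * y i) = fun i =>
      ∑ f : Fin (d i) → Fin 6, (y i).coeff (spell f) •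
        MonoidAlgebra.single (spell (a i) * spell f) (1 : K) := by
    funext i
    conv_lhs => rw [eq_sum_spell_of_mem_Hgr (hy i)]
    simp [Finset.mul_sum, MonoidAlgebra.single_mul_single]
  rw [h, ← MultilinearMap.mkPiAlgebraFin_apply (R := K), MultilinearMap.map_sum]
  refine Finset.sum_congr rfl fun b _ => ?_
  rw [MultilinearMap.map_smul_univ, MultilinearMap.mkPiAlgebraFin_apply, ofFn_prod_single]
  rfl

theorem span_translates_eq_top {K G ι : Type} [Field K] [AddCommGroup G] [UniqueSums G]
    [Fintype ι] {c : ι → G} (hc : Function.Injective c) {ψ : AddMonoidAlgebra K G}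
    (hψ : ψ ≠ 0) :
    Submodule.span K (Set.range fun (n : G) (i : ι) => ψ.coeff (n - c i)) = ⊤ := by
  by_contra htop
  obtain ⟨f, hf, hle⟩ := Submodule.exists_le_ker_of_lt_top _ (lt_top_iff_ne_top.2 htop)
  have hfy : ∀ z : ι → K, f z = ∑ i, f (Pi.single i 1) * z i := by
    intro z
    conv_lhs => rw [pi_eq_sum_univ' z]
    rw [map_sum]
    refine Finset.sum_congr rfl fun i _ => ?_
    rw [map_smul, smul_eq_mul, mul_comm]
  let y : AddMonoidAlgebra K G := ∑ i, AddMonoidAlgebra.single (c i) (f (Pi.single i 1))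
  have hmul : y * ψ = 0 := by
    ext n
    have h0 : f (fun i => ψ.coeff (n - c i)) = 0 := hle (Submodule.subset_span ⟨n, rfl⟩)
    rw [hfy] at h0
    rw [Finset.sum_mul, AddMonoidAlgebra.coeff_sum, Finsupp.finsetSum_apply,
      AddMonoidAlgebra.coeff_zero, Finsupp.zero_apply, ← h0]
    refine Finset.sum_congr rfl fun i _ => ?_
    rw [AddMonoidAlgebra.coeff_single_mul_eq_mul_coeff (n - c i)]
    exact fun m _ => by rw [eq_sub_iff_add_eq, add_comm]
  have hy : y = 0 := (mul_eq_zero.1 hmul).resolve_right hψ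
  apply hf
  ext i
  have := congrArg (fun z => z.coeff (c i)) hy
  simp only [y, AddMonoidAlgebra.coeff_sum, Finsupp.finsetSum_apply,
    AddMonoidAlgebra.coeff_single, AddMonoidAlgebra.coeff_zero, Finsupp.zero_apply] at this
  rw [Finset.sum_eq_single i] at this
  · simpa using this
  · intro j _ hj
    exact Finsupp.single_eq_of_ne fun h => hj (hc h).symm
  · simp

theorem card_le_of_span_translates_le {K G ι : Type} [Field K] [AddCommGroup G] [UniqueSums G]
    [Fintype ι] {c : ι → G} (hc : Function.Injective c) {ψ : AddMonoidAlgebra K G}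
    (hψ : ψ ≠ 0) {t : ℕ} (y : Fin t → ι → K)
    (h : ∀ n, (fun i => ψ.coeff (n - c i)) ∈ Submodule.span K (Set.range y)) :
    Fintype.card ι ≤ t := by
  have htop : Submodule.span K (Set.range y) = ⊤ := by
    rw [eq_top_iff, ← span_translates_eq_top hc hψ, Submodule.span_le]
    rintro _ ⟨n, rfl⟩
    exact h n
  have := finrank_range_le_card (R := K) y
  rwa [Set.finrank, htop, finrank_top, Module.finrank_fintype_fun_eq_card, Fintype.card_fin]
    at this

theorem exists_letterCount_injective {s : ℕ} {e : Fin s → ℕ} (p : ∀ i, Fin (e i) → Fin 2) :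
    ∃ (h : ℕ) (a : Fin (h / 2 + 1) × Fin (h / 2 + 1) → ∀ i, Fin (e i) → Fin 6),
      ∑ i, e i ≤ 2 * h ∧ (∀ x, (fun i => bf ∘ a x i) = p) ∧
        Function.Injective fun x => letterCount (a x) := by
  let X : Fin 2 → Finset (Σ i, Fin (e i)) := fun τ => {x | p x.1 x.2 = τ}
  obtain ⟨τ, hτ⟩ : ∃ τ, ∑ i, e i ≤ 2 * (X τ).card := by
    have hX : (X 0).card + (X 1).card = ∑ i, e i := by
      have h1 : X 1 = (X 0)ᶜ := by
        ext x
        simp only [X, Finset.mem_filter, Finset.mem_univ, true_and, Finset.mem_compl]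
        generalize p x.1 x.2 = z
        fin_cases z <;> simp
      rw [h1, Finset.card_add_card_compl]
      simp
    by_contra! hlt
    have h0 := hlt 0
    have h1 := hlt 1
    omega
  have hST : ∀ x : Fin ((X τ).card / 2 + 1) × Fin ((X τ).card / 2 + 1),
      ∃ S T : Finset (Σ i, Fin (e i)), S ⊆ X τ ∧ T ⊆ X τ \ S ∧
        S.card = x.1 ∧ T.card = x.2 := by
    rintro ⟨i, j⟩
    obtain ⟨S, hS, hSc⟩ := Finset.exists_subset_card_eq (s := X τ) (n := i) (by omega)
    obtain ⟨T, hT, hTc⟩ := Finset.exists_subset_card_eq (s := X τ \ S) (n := j) (by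
      rw [Finset.card_sdiff_of_subset hS]
      omega)
    exact ⟨S, T, hS, hT, hSc, hTc⟩
  choose S T hS hT hSc hTc using hST
  let first : Fin 2 → Fin 6 := ![0, 3]
  let second : Fin 2 → Fin 6 := ![1, 4]
  let third : Fin 2 → Fin 6 := ![2, 5]
  have hfirst : ∀ σ, bf (first σ) = σ := by decide
  have hsecond : ∀ σ, bf (second σ) = σ := by decide
  have hthird : ∀ σ, bf (third σ) = σ := by decide
  have h12 : ∀ σ ρ, first σ ≠ second ρ := by decide
  have h13 : ∀ σ ρ, first σ ≠ third ρ := by decide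
  have h23 : ∀ σ ρ, second σ ≠ third ρ := by decide
  let a : Fin ((X τ).card / 2 + 1) × Fin ((X τ).card / 2 + 1) → ∀ i, Fin (e i) → Fin 6 :=
    fun x i j => if ⟨i, j⟩ ∈ S x then first τ else if ⟨i, j⟩ ∈ T x then second τ
      else third (p i j)
  have hcount : ∀ x l, letterCount (a x) l =
      ((Finset.univ.filter fun z : Σ i, Fin (e i) => a x z.1 z.2 = l).card : ℤ) := by
    intro x l
    rw [letterCount, Finset.card_filter, Nat.cast_sum, Fintype.sum_sigma]
    simp
  have hc1 : ∀ x, letterCount (a x) (first τ) = x.1 := by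
    intro x
    rw [hcount, ← hSc]
    congr 2
    ext ⟨i, j⟩
    simp only [Finset.mem_filter, Finset.mem_univ, true_and, a]
    split_ifs with h1 h2
    · simp [h1]
    · simp [h1, (h12 _ _).symm]
    · simp [h1, (h13 _ _).symm]
  have hc2 : ∀ x, letterCount (a x) (second τ) = x.2 := by
    intro x
    rw [hcount, ← hTc]
    congr 2
    ext ⟨i, j⟩
    simp only [Finset.mem_filter, Finset.mem_univ, true_and, a]
    split_ifs with h1 h2
    · simp only [h12, false_iff]
      exact fun h => (Finset.mem_sdiff.1 (hT x h)).2 h1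
    · simp [h2]
    · simp [h2, (h23 _ _).symm]
  refine ⟨(X τ).card, a, hτ, ?_, ?_⟩
  · intro x
    funext i j
    simp only [Function.comp_apply, a]
    split_ifs with h1 h2
    · have := hS x h1
      simp only [X, Finset.mem_filter, Finset.mem_univ, true_and] at this
      rw [hfirst, this]
    · have := (Finset.mem_sdiff.1 (hT x h2)).1
      simp only [X, Finset.mem_filter, Finset.mem_univ, true_and] at this
      rw [hsecond, this]
    · exact hthird _
  · intro x y hxy
    have h1 := congrFun hxy (first τ)
    have h2 := congrFun hxy (second τ)
    simp only [hc1, hc2] at h1 h2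
    ext
    · exact_mod_cast h1
    · exact_mod_cast h2

theorem map_wComp_mem_of_blockwise {K : Type} [Field K] {s : ℕ} {e d : Fin s → ℕ}
    {R : FreeA K →ₗ[K] FreeA K} {G : (∀ i, Fin (d i) → Fin 6) → (∀ i, Fin (d i) → Fin 6) → K}
    (hR : ∀ (a : ∀ i, Fin (e i) → Fin 6) (b : ∀ i, Fin (d i) → Fin 6),
      R (MonoidAlgebra.single (interleave a b) 1) =
        ∑ b', G b b' • MonoidAlgebra.single (interleave a b') 1)
    (p : ∀ i, Fin (e i) → Fin 2) (q : ∀ i, Fin (d i) → Fin 2) {t : ℕ} (gs : Fin t → FreeA K)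
    (ht : ∀ h, ∑ i, e i ≤ 2 * h → t < (h / 2 + 1) * (h / 2 + 1))
    (hyp : ∀ n, R (wComp K (interleave p q) n) ∈
      Submodule.map R (SP K (interleave p q)) ⊔ Submodule.span K (Set.range gs))
    (n : Fin 6 → ℤ) :
    R (wComp K (interleave p q) n) ∈ Submodule.map R (SP K (interleave p q)) := by
  let N : Submodule K ((∀ i, Fin (d i) → Fin 6) → K) := Submodule.span K
    {x | ∃ b, prec (interleave p fun i => bf ∘ b i) (interleave p q) ∧ x = G b}
  let Φ : (Fin 6 → ℤ) → (∀ i, Fin (d i) → Fin 6) → K := fun k =>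
    ∑ b : ∀ i, Fin (d i) → Fin 6 with (fun i => bf ∘ b i) = q ∧ letterCount b = k, G b
  by_cases hΦ : ∀ k, Φ k ∈ N
  · rw [wComp_interleave, map_sum]
    refine Submodule.sum_mem _ fun a ha => ?_
    rw [Finset.mem_filter] at ha
    let ins : ((∀ i, Fin (d i) → Fin 6) → K) →ₗ[K] FreeA K :=
      Fintype.linearCombination K fun b => MonoidAlgebra.single (interleave a b) 1
    have hins : ∀ b, R (MonoidAlgebra.single (interleave a b) 1) = ins (G b) := fun b => by
      rw [hR, Fintype.linearCombination_apply]
    rw [map_sum, Finset.sum_congr rfl fun b _ => hins b, ← map_sum]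
    have hN : N ≤ (Submodule.map R (SP K (interleave p q))).comap ins := by
      rw [Submodule.span_le]
      rintro _ ⟨b, hb, rfl⟩
      rw [SetLike.mem_coe, Submodule.mem_comap, ← hins]
      refine Submodule.mem_map_of_mem (Submodule.subset_span ⟨_, ?_, ?_, rfl⟩)
      · simp [len_interleave]
      · rwa [bm_interleave, ha.2]
    exact hN (hΦ _)
  · exfalso
    push Not at hΦ
    obtain ⟨k, hk⟩ := hΦ
    obtain ⟨φ, hφk, hφN⟩ := Submodule.exists_le_ker_of_notMem hk
    obtain ⟨h, a, hh, hap, hinj⟩ := exists_letterCount_injective p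
    let ψ : AddMonoidAlgebra K (Fin 6 → ℤ) :=
      ∑ b : ∀ i, Fin (d i) → Fin 6 with (fun i => bf ∘ b i) = q,
        AddMonoidAlgebra.single (letterCount b) (φ (G b))
    have hψ : ∀ m, ψ.coeff m = φ (Φ m) := by
      intro m
      simp only [ψ, Φ, AddMonoidAlgebra.coeff_sum, Finsupp.finsetSum_apply,
        AddMonoidAlgebra.coeff_single, Finsupp.single_apply, map_sum]
      rw [← Finset.sum_filter, Finset.filter_filter]
    have hψ0 : ψ ≠ 0 := by
      intro h0
      apply hφk
      rw [← hψ, h0]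
      rfl
    let L : FreeA K →ₗ[K] (Fin (h / 2 + 1) × Fin (h / 2 + 1)) → K :=
      LinearMap.pi fun x => φ ∘ₗ LinearMap.pi fun b =>
        Finsupp.lapply (interleave (a x) b) ∘ₗ
          (MonoidAlgebra.coeffLinearEquiv K).toLinearMap
    have hL : ∀ a' b x, L (R (MonoidAlgebra.single (interleave a' b) 1)) x =
        if a' = a x then φ (G b) else 0 := by
      intro a' b x
      have hx : L (R (MonoidAlgebra.single (interleave a' b) 1)) x =
          φ fun b' => (R (MonoidAlgebra.single (interleave a' b) 1)).coeff
            (interleave (a x) b') := rfl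
      rw [hx, hR]
      split_ifs with hax
      · congr 1
        funext b'
        simp [hax, Finsupp.single_apply, interleave_inj]
      · convert map_zero φ
        simp [hax, interleave_inj]
    have hLS : Submodule.map R (SP K (interleave p q)) ≤ LinearMap.ker L := by
      rw [Submodule.map_le_iff_le_comap, SP, Submodule.span_le]
      rintro _ ⟨w, hw, hpw, rfl⟩
      rw [len_interleave] at hw
      obtain ⟨a', b, rfl⟩ := exists_interleave_eq hw
      rw [SetLike.mem_coe, Submodule.mem_comap, LinearMap.mem_ker]
      funext x
      rw [hL]
      split_ifs with hax
      · rw [bm_interleave, hax, hap] at hpw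
        exact hφN (Submodule.subset_span ⟨b, hpw, rfl⟩)
      · rfl
    have hLw : ∀ n, L (R (wComp K (interleave p q) n)) =
        fun x => ψ.coeff (n - letterCount (a x)) := by
      intro n
      funext x
      rw [wComp_interleave, hψ]
      simp only [map_sum, Finset.sum_apply, hL]
      rw [Finset.sum_eq_single (a x)]
      · simp [Φ]
      · intro a' _ ha'
        simp [ha']
      · intro hx
        simp [hap x] at hx
    have hle := card_le_of_span_translates_le hinj hψ0 (L ∘ gs) fun n => by
      have := Submodule.mem_map_of_mem (f := L) (hyp n)
      rw [Submodule.map_sup, LinearMap.le_ker_iff_map.1 hLS, bot_sup_eq,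
        Submodule.map_span, ← Set.range_comp, hLw] at this
      exact this
    rw [Fintype.card_prod, Fintype.card_fin] at hle
    exact absurd hle (ht h hh).not_ge

theorem stmt13 (K : Type) [Field K] (m : ℕ → ℕ)
    (hmono : StrictMono m) (hm1 : 10 ^ 8 < m 0)
    (hdvd : ∀ i, 40 * m i ∣ m (i + 1)) (hgrow : ∀ i, 2 ^ (i + 102) * m i < m (i + 1))
    (F : ℕ → Finset (FreeA K)) (hF : ∀ i, (F i : Set (FreeA K)) ⊆ (Hgr K (m i) : Set (FreeA K)))
    (R c : ℕ → (FreeA K →ₗ[K] FreeA K))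
    (hR0 : ∀ a ∈ Hgr K (m 0), R 0 a = a)
    (hRH : ∀ i, ∀ a ∈ Hgr K (m i), R i a ∈ Hgr K (m i))
    (hcH : ∀ i, ∀ a ∈ Hgr K (m i), c i a ∈ Hgr K (m i))
    (hcker : ∀ i, ∀ a ∈ Hgr K (m i),
      (c i a = 0 ↔ a ∈ Submodule.span K (⇑(R i) '' (F i : Set (FreeA K)))))
    (hrec : ∀ (i : ℕ) (l : List (FreeMonoid (Fin 6))),
      l.length = m (i + 1) / m i → (∀ w ∈ l, len w = m i) →
      R (i + 1) (MonoidAlgebra.single l.prod 1) =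
        c i (R i (MonoidAlgebra.single l.headI 1)) *
          (l.tail.map fun w => R i (MonoidAlgebra.single w 1)).prod)
    -- the fixed block decomposition of the degree `m k`
    (k s : ℕ) (e d : Fin s → ℕ)
    (hed : 50 * (∑ i, d i) < (∑ i, e i)) (hsum : (∑ i, (e i + d i)) = m k)
    (g : Fin s → (FreeA K →ₗ[K] FreeA K))
    (hgH : ∀ i, ∀ a ∈ Hgr K (d i), g i a ∈ Hgr K (d i))
    (hfact : ∀ U V : Fin s → FreeMonoid (Fin 6),
      (∀ i, len (U i) = e i) → (∀ i, len (V i) = d i) →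
      R k (MonoidAlgebra.single (List.ofFn fun i => U i * V i).prod 1) =
        (List.ofFn fun i =>
          MonoidAlgebra.single (U i) (1 : K) * g i (MonoidAlgebra.single (V i) 1)).prod)
    -- the permutation `σ`, the linear maps induced by `σ` and `σ⁻¹`, and `f_k`
    (σ : Equiv.Perm (Fin (m k))) (Pσ Pτ fk : FreeA K →ₗ[K] FreeA K)
    (hPσ : ∀ fn : Fin (m k) → Fin 6,
      Pσ (MonoidAlgebra.single (wordOfFn fn) 1) = MonoidAlgebra.single (wordOfFn (fn ∘ σ)) 1)
    (hPτ : ∀ fn : Fin (m k) → Fin 6,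
      Pτ (MonoidAlgebra.single (wordOfFn fn) 1) = MonoidAlgebra.single (wordOfFn (fn ∘ σ.symm)) 1)
    (hσ : ∀ U V : Fin s → FreeMonoid (Fin 6),
      (∀ i, len (U i) = e i) → (∀ i, len (V i) = d i) →
      Pσ (MonoidAlgebra.single (List.ofFn fun i => U i * V i).prod 1) =
        MonoidAlgebra.single ((List.ofFn U).prod * (List.ofFn V).prod) 1)
    (hfk : ∀ V : Fin s → FreeMonoid (Fin 6), (∀ i, len (V i) = d i) →
      fk (MonoidAlgebra.single (List.ofFn V).prod 1) =
        (List.ofFn fun i => g i (MonoidAlgebra.single (V i) 1)).prod)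
    -- the data of the statement
    (U V : Fin s → FreeMonoid (Fin 6))
    (hU : ∀ i, len (U i) = e i) (hV : ∀ i, len (V i) = d i)
    (w u v : FreeMonoid (Fin 6))
    (hw : w = (List.ofFn fun i => U i * V i).prod)
    (hu : u = (List.ofFn U).prod) (hv : v = (List.ofFn V).prod)
    (t : ℕ) (ht : 10 ^ 4 * t ≤ (m k) ^ 2) (gs : Fin t → FreeA K)
    (hyp : ∀ n : Fin 6 → ℤ,
      R k (wComp K (bm w) n) ∈
        Submodule.map (R k) (SP K (bm w)) ⊔ Submodule.span K (Set.range gs)) :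
    ∀ n : Fin 6 → ℤ, R k (wComp K (bm w) n) ∈ Submodule.map (R k) (SP K (bm w)) := by
  choose a₀ ha₀ using fun i => exists_spell_eq (hU i)
  choose b₀ hb₀ using fun i => exists_spell_eq (hV i)
  have hw' : w = interleave a₀ b₀ := by
    simp only [hw, interleave, ha₀, hb₀]
  rw [hw', bm_interleave] at hyp ⊢
  refine map_wComp_mem_of_blockwise
    (G := fun b b' => ∏ i, (g i (MonoidAlgebra.single (spell (b i)) 1)).coeff (spell (b' i)))
    ?_ _ _ gs ?_ hyp
  · intro a b
    rw [interleave, hfact _ _ (fun i => len_spell _) fun i => len_spell _]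
    exact ofFn_prod_eq_sum_interleave a fun i =>
      hgH i _ (Submodule.subset_span ⟨_, len_spell _, rfl⟩)
  · intro h hh
    rw [Finset.sum_add_distrib] at hsum
    have hm : m k < 8 * (h / 2 + 1) := by omega
    nlinarith [Nat.mul_lt_mul'' hm hm]
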